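/- Two alternating n×n matrices over a field F are U-congruent if and only if they are U-equivalent. -/

import Mathlib

open Matrix

variable {F : Type*} [Field F] {n : ℕ}

/-- Membership in `U`: upper triangular matrices with all diagonal entries 1. -/
def InU (h : Matrix (Fin n) (Fin n) F) : Prop :=
  (∀ i, h i i = 1) ∧ ∀ i j : Fin n, j < i → h i j = 0

/-- An alternating matrix: `Xᵀ = -X` and all diagonal entries are 0. -/
def IsAlternating (X : Matrix (Fin n) (Fin n) F) : Prop :=
  Xᵀ = -X ∧ ∀ i, X i i = 0

theorem InU.one : InU (1 : Matrix (Fin n) (Fin n) F) :=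
  ⟨fun i => one_apply_eq i, fun _ _ hij => one_apply_ne hij.ne'⟩

theorem mul_apply_self_of_upper {h k : Matrix (Fin n) (Fin n) F}
    (hh : ∀ i j : Fin n, j < i → h i j = 0) (hk : ∀ i j : Fin n, j < i → k i j = 0) (i : Fin n) :
    (h * k) i i = h i i * k i i := by
  rw [Matrix.mul_apply]
  refine Finset.sum_eq_single i (fun b _ hb => ?_) (by simp)
  rcases lt_or_gt_of_ne hb with hb | hb
  · rw [hh i b hb, zero_mul]
  · rw [hk b i hb, mul_zero]

theorem InU.mul {h k : Matrix (Fin n) (Fin n) F} (hh : InU h) (hk : InU k) : InU (h * k) := by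
  refine ⟨fun i => ?_, fun i j hij => ?_⟩
  · rw [mul_apply_self_of_upper hh.2 hk.2, hh.1, hk.1, one_mul]
  · rw [Matrix.mul_apply]
    refine Finset.sum_eq_zero fun b _ => ?_
    rcases lt_or_ge b i with hb | hb
    · rw [hh.2 i b hb, zero_mul]
    · rw [hk.2 b j (hij.trans_le hb), mul_zero]

theorem InU.exists_inverse {h : Matrix (Fin n) (Fin n) F} (hh : InU h) :
    ∃ g, InU g ∧ h * g = 1 ∧ g * h = 1 := by
  have hb : h.BlockTriangular id := fun i j hij => hh.2 i j hij
  have hdet : IsUnit h.det := by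
    rw [det_of_isUpperTriangular hb]
    simp [hh.1]
  let := invertibleOfIsUnitDet h hdet
  have hinv : ∀ i j : Fin n, j < i → h⁻¹ i j = 0 := fun i j hij =>
    blockTriangular_inv_of_blockTriangular hb hij
  refine ⟨h⁻¹, ⟨fun i => ?_, hinv⟩, mul_nonsing_inv h hdet, nonsing_inv_mul h hdet⟩
  have := mul_apply_self_of_upper hh.2 hinv i
  rw [mul_nonsing_inv h hdet, one_apply_eq, hh.1, one_mul] at this
  exact this.symm

theorem IsAlternating.apply_swap {X : Matrix (Fin n) (Fin n) F} (hX : IsAlternating X)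
    (i j : Fin n) : X j i = -X i j := congrFun (congrFun hX.1 i) j

theorem IsAlternating.equivalent_swap {X Y h k : Matrix (Fin n) (Fin n) F}
    (hX : IsAlternating X) (hY : IsAlternating Y) (hYX : Y = hᵀ * X * k) : Y = kᵀ * X * h := by
  have h1 := congrArg transpose hYX
  rwa [hY.1, transpose_mul, transpose_mul, hX.1, transpose_transpose, Matrix.neg_mul,
    Matrix.mul_neg, neg_inj, ← Matrix.mul_assoc] at h1

theorem transpose_mul_mul_apply (h X k : Matrix (Fin n) (Fin n) F) (p q : Fin n) :
    (hᵀ * X * k) p q = ∑ r, ∑ s, h r p * X r s * k s q := by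
  rw [Finset.sum_comm]
  simp only [Matrix.mul_apply, transpose_apply, Finset.sum_mul]

/-- A form vanishing on rows above `m` has its row `m` changed only by the right factor. -/
theorem InU.transpose_mul_mul_row {h X : Matrix (Fin n) (Fin n) F} (k : Matrix (Fin n) (Fin n) F)
    (hh : InU h) {m : Fin n} (hm : ∀ i < m, ∀ j, X i j = 0) (q : Fin n) :
    (hᵀ * X * k) m q = ∑ s, X m s * k s q := by
  rw [transpose_mul_mul_apply, Finset.sum_eq_single m]
  · simp [hh.1]
  · intro r _ hr
    refine Finset.sum_eq_zero fun s _ => ?_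
    rcases lt_or_gt_of_ne hr with hr | hr
    · simp [hm r hr]
    · simp [hh.2 r m hr]
  · simp

/-- `X` is alternating, supported on `S`, and splits off a hyperbolic plane spanned by
the basis vectors `m` and `j`. -/
structure SplitsAt (S : Finset (Fin n)) (m j : Fin n) (a : F) (X : Matrix (Fin n) (Fin n) F) :
    Prop where
  alt : IsAlternating X
  supp : ∀ i ∉ S, ∀ q, X i q = 0
  row_left : ∀ q, X m q = if q = j then a else 0
  row_right : ∀ q, X j q = if q = m then -a else 0

/-- One step of the symplectic Gram–Schmidt process inside `U`. -/
theorem exists_splitsAt {S : Finset (Fin n)} {m j : Fin n} {X : Matrix (Fin n) (Fin n) F}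
    (hX : IsAlternating X) (hS : ∀ i ∉ S, ∀ q, X i q = 0) (hmin : ∀ i ∈ S, m ≤ i)
    (ha : X m j ≠ 0) (hj : ∀ i < j, X m i = 0) :
    ∃ u, InU u ∧ SplitsAt S m j (X m j) (uᵀ * X * u) := by
  have hmj : m ≠ j := by
    rintro rfl
    exact ha (hX.2 m)
  have hmS : m ∈ S := by
    by_contra hm
    exact ha (hS m hm j)
  have hjS : j ∈ S := by
    by_contra hm
    exact ha (by rw [hX.apply_swap, hS j hm, neg_zero])
  set a := X m j with ha'
  obtain ⟨α, hα⟩ : ∃ α : Fin n → F, ∀ q, α q = if q = m ∨ q = j then 0 else -(X m q / a) :=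
    ⟨_, fun _ => rfl⟩
  obtain ⟨β, hβ⟩ : ∃ β : Fin n → F, ∀ q, β q = if q = m ∨ q = j then 0 else -(X q j / a) :=
    ⟨_, fun _ => rfl⟩
  obtain ⟨u, hu⟩ : ∃ u : Matrix (Fin n) (Fin n) F, ∀ i q, u i q =
      (if i = q then 1 else 0) + (if i = j then α q else 0) + (if i = m then β q else 0) :=
    ⟨of fun _ _ => _, fun _ _ => rfl⟩
  have hform : ∀ p q, (uᵀ * X * u) p q =
      (X p q + α q * X p j + β q * X p m) + α p * (X j q + α q * X j j + β q * X j m) +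
      β p * (X m q + α q * X m j + β q * X m m) := by
    intro p q
    rw [transpose_mul_mul_apply]
    simp only [hu, mul_add, add_mul, Finset.sum_add_distrib, ite_mul, mul_ite, zero_mul,
      mul_zero, one_mul, mul_one, Finset.sum_ite_eq', Finset.mem_univ, if_true]
    ring
  have hjm : X j m = -a := hX.apply_swap m j
  refine ⟨u, ⟨fun i => ?_, fun i q hiq => ?_⟩, ⟨?_, fun p => ?_⟩, fun p hp q => ?_,
    fun q => ?_, fun q => ?_⟩
  · simp only [hu, hα, hβ]
    aesop
  · have h1 : i = j → α q = 0 := by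
      rintro rfl
      simp [hα, hj q hiq]
    have h2 : i = m → β q = 0 := by
      rintro rfl
      have : q ∉ S := fun hq => (hmin q hq).not_gt hiq
      simp [hβ, hS q this]
    simp only [hu, if_neg hiq.ne']
    split_ifs <;> simp_all
  · rw [transpose_mul, transpose_mul, hX.1, transpose_transpose]
    simp [Matrix.mul_assoc]
  · rw [hform, hX.2, hX.2, hX.2, hX.apply_swap p j, hX.apply_swap p m, hX.apply_swap m j]
    ring
  · have hpm : p ≠ m := fun h => hp (h ▸ hmS)
    have hpj : p ≠ j := fun h => hp (h ▸ hjS)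
    have h1 : α p = 0 := by rw [hα, hX.apply_swap p m, hS p hp]; simp
    have h2 : β p = 0 := by rw [hβ, hS p hp]; simp
    rw [hform, h1, h2, hS p hp, hS p hp, hS p hp]
    ring
  · have h1 : α m = 0 := by simp [hα]
    have h2 : β m = 0 := by simp [hβ]
    rw [hform, h1, h2, hX.2 m, ← ha', hα]
    rcases eq_or_ne q m with rfl | hqm
    · simp [hX.2, hmj]
    rcases eq_or_ne q j with rfl | hqj
    · simp [ha']
    · simp only [hqm, hqj, or_self, if_false]
      field_simp
      ring
  · have h1 : α j = 0 := by simp [hα]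
    have h2 : β j = 0 := by simp [hβ]
    rw [hform, h1, h2, hX.2 j, hjm, hβ]
    rcases eq_or_ne q m with rfl | hqm
    · simp [hjm]
    rcases eq_or_ne q j with rfl | hqj
    · simp [hX.2, hqm]
    · simp only [hqm, hqj, or_self, if_false]
      rw [hX.apply_swap q j]
      field_simp
      ring

/-- The compression of `g` to the coordinates in `T`, extended by the identity. -/
def cutTo (T : Finset (Fin n)) (g : Matrix (Fin n) (Fin n) F) : Matrix (Fin n) (Fin n) F :=
  of fun i j => if i ∈ T ∧ j ∈ T then g i j else if i = j then 1 else 0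

/-- The compression of `X` to the coordinates in `T`, extended by zero. -/
def restrictTo (T : Finset (Fin n)) (X : Matrix (Fin n) (Fin n) F) : Matrix (Fin n) (Fin n) F :=
  of fun i j => if i ∈ T ∧ j ∈ T then X i j else 0

theorem InU.cutTo {g : Matrix (Fin n) (Fin n) F} (hg : InU g) (T : Finset (Fin n)) :
    InU (cutTo T g) := by
  refine ⟨fun i => ?_, fun i j hij => ?_⟩
  · simp [_root_.cutTo, hg.1]
  · simp [_root_.cutTo, hg.2 i j hij, hij.ne']

theorem IsAlternating.restrictTo {X : Matrix (Fin n) (Fin n) F} (hX : IsAlternating X)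
    (T : Finset (Fin n)) : IsAlternating (restrictTo T X) := by
  refine ⟨?_, fun i => by simp [_root_.restrictTo, hX.2]⟩
  ext i j
  rw [transpose_apply, neg_apply]
  by_cases hi : i ∈ T <;> by_cases hj : j ∈ T <;>
    simp [_root_.restrictTo, hi, hj, hX.apply_swap i j]

theorem restrictTo_of_notMem {T : Finset (Fin n)} (X : Matrix (Fin n) (Fin n) F) {i : Fin n}
    (hi : i ∉ T) (q : Fin n) : restrictTo T X i q = 0 := by
  simp [restrictTo, hi]

theorem SplitsAt.right_row {S : Finset (Fin n)} {m j : Fin n} {a : F}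
    {X Y h k : Matrix (Fin n) (Fin n) F} (hX : SplitsAt S m j a X) (hY : SplitsAt S m j a Y)
    (ha : a ≠ 0) (hmin : ∀ i ∈ S, m ≤ i) (hh : InU h) (hYX : Y = hᵀ * X * k) (q : Fin n) :
    k j q = if q = j then 1 else 0 := by
  have h1 := InU.transpose_mul_mul_row (X := X) k hh (m := m)
    (fun i hi => hX.supp i fun hS => (hmin i hS).not_gt hi) q
  rw [← hYX, hY.row_left] at h1
  simp only [hX.row_left, ite_mul, zero_mul, Finset.sum_ite_eq', Finset.mem_univ, if_true] at h1
  split_ifs at h1 ⊢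
  · exact mul_left_cancel₀ ha (by rw [← h1, mul_one])
  · exact (mul_eq_zero.mp h1.symm).resolve_left ha

/-- Off `S \ {m, j}`, a split form is determined by `m`, `j` and `a`. -/
theorem SplitsAt.apply_of_notMem {S : Finset (Fin n)} {m j : Fin n} {a : F}
    {X : Matrix (Fin n) (Fin n) F} (hX : SplitsAt S m j a X) {p : Fin n}
    (hp : p ∉ (S.erase m).erase j) (q : Fin n) :
    X p q = if p = m then (if q = j then a else 0) else
      if p = j then (if q = m then -a else 0) else 0 := by
  split_ifs with h1 h2 h3 h4
  · subst h1 h2; simp [hX.row_left]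
  · subst h1; simp [hX.row_left, h2]
  · subst h3 h4; simp [hX.row_right]
  · subst h3; simp [hX.row_right, h4]
  · exact hX.supp p (by simp_all) q

theorem SplitsAt.apply_eq_zero {S : Finset (Fin n)} {m j : Fin n} {a : F}
    {X : Matrix (Fin n) (Fin n) F} (hX : SplitsAt S m j a X) {p q : Fin n}
    (hp : p ∉ (S.erase m).erase j) (hq : q ∈ (S.erase m).erase j) : X p q = 0 := by
  rw [hX.apply_of_notMem hp]
  simp only [Finset.mem_erase] at hq
  simp [hq.1, hq.2.1]

theorem SplitsAt.apply_eq_zero' {S : Finset (Fin n)} {m j : Fin n} {a : F}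
    {X : Matrix (Fin n) (Fin n) F} (hX : SplitsAt S m j a X) {p q : Fin n}
    (hp : p ∈ (S.erase m).erase j) (hq : q ∉ (S.erase m).erase j) : X p q = 0 := by
  rw [hX.alt.apply_swap, hX.apply_eq_zero hq hp, neg_zero]

theorem SplitsAt.restrictTo_equivalent {S : Finset (Fin n)} {m j : Fin n} {a : F}
    {X Y h k : Matrix (Fin n) (Fin n) F} (hX : SplitsAt S m j a X)
    (hh : ∀ q, h j q = if q = j then 1 else 0) (hk : ∀ q, k j q = if q = j then 1 else 0)
    (hYX : Y = hᵀ * X * k) :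
    restrictTo ((S.erase m).erase j) Y = (cutTo ((S.erase m).erase j) h)ᵀ *
      restrictTo ((S.erase m).erase j) X * cutTo ((S.erase m).erase j) k := by
  set T := (S.erase m).erase j with hT
  have hjT : j ∉ T := by simp [hT]
  ext p q
  rw [transpose_mul_mul_apply]
  by_cases hpq : p ∈ T ∧ q ∈ T
  · have hpj : p ≠ j := fun h => hjT (h ▸ hpq.1)
    have hqj : q ≠ j := fun h => hjT (h ▸ hpq.2)
    simp only [restrictTo, of_apply, hpq, and_self, if_true]
    rw [hYX, transpose_mul_mul_apply]
    refine Finset.sum_congr rfl fun r _ => Finset.sum_congr rfl fun s _ => ?_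
    by_cases hr : r ∈ T
    · by_cases hs : s ∈ T
      · simp [cutTo, hr, hs, hpq]
      · simp [hs, hX.apply_eq_zero' hr hs]
    · simp only [hr, false_and, if_false, mul_zero, zero_mul]
      rw [hX.apply_of_notMem hr]
      split_ifs with h1 h2 h3 h4
      · subst h2; simp [hk, hqj]
      · simp
      · subst h3; simp [hh, hpj]
      · simp
      · simp
  · symm
    simp only [restrictTo, of_apply, if_neg hpq]
    refine Finset.sum_eq_zero fun r _ => Finset.sum_eq_zero fun s _ => ?_
    by_cases hrs : r ∈ T ∧ s ∈ T
    · rcases not_and_or.mp hpq with hp | hq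
      · have : r ≠ p := fun h => hp (h ▸ hrs.1)
        simp [cutTo, hp, this]
      · have : s ≠ q := fun h => hq (h ▸ hrs.2)
        simp [cutTo, hq, this]
    · simp [hrs]

theorem SplitsAt.congruent_of_restrictTo {S : Finset (Fin n)} {m j : Fin n} {a : F}
    {X Y g : Matrix (Fin n) (Fin n) F} (hX : SplitsAt S m j a X) (hY : SplitsAt S m j a Y)
    (hg : restrictTo ((S.erase m).erase j) Y = gᵀ * restrictTo ((S.erase m).erase j) X * g) :
    Y = (cutTo ((S.erase m).erase j) g)ᵀ * X * cutTo ((S.erase m).erase j) g := by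
  set T := (S.erase m).erase j with hT
  have cut_out : ∀ r p, p ∉ T → cutTo T g r p = if r = p then 1 else 0 := by
    intro r p hp
    simp [cutTo, hp]
  have cut_in : ∀ r p, p ∈ T → r ∉ T → cutTo T g r p = 0 := by
    intro r p hp hr
    have : r ≠ p := fun h => hr (h ▸ hp)
    simp [cutTo, hr, this]
  ext p q
  rw [transpose_mul_mul_apply]
  by_cases hp : p ∈ T
  · by_cases hq : q ∈ T
    · have h1 := congrFun (congrFun hg p) q
      rw [transpose_mul_mul_apply] at h1
      simp only [restrictTo, of_apply, hp, hq, and_self, if_true] at h1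
      rw [h1]
      refine Finset.sum_congr rfl fun r _ => Finset.sum_congr rfl fun s _ => ?_
      by_cases hr : r ∈ T
      · by_cases hs : s ∈ T
        · simp [cutTo, hr, hs, hp, hq]
        · simp [hs, cut_in s q hq hs]
      · simp [hr, cut_in r p hp hr]
    · rw [hY.apply_eq_zero' hp hq]
      symm
      refine Finset.sum_eq_zero fun r _ => Finset.sum_eq_zero fun s _ => ?_
      by_cases hr : r ∈ T
      · by_cases hs : s = q
        · subst hs; simp [hX.apply_eq_zero' hr hq]
        · simp [cut_out s q hq, hs]
      · simp [cut_in r p hp hr]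
  · simp only [cut_out _ p hp, ite_mul, one_mul, zero_mul, Finset.sum_ite_irrel,
      Finset.sum_const_zero, Finset.sum_ite_eq', Finset.mem_univ, if_true]
    by_cases hq : q ∈ T
    · rw [hY.apply_eq_zero hp hq]
      symm
      refine Finset.sum_eq_zero fun s _ => ?_
      by_cases hs : s ∈ T
      · simp [hX.apply_eq_zero hp hs]
      · simp [cut_in s q hq hs]
    · simp only [cut_out _ q hq, mul_ite, mul_one, mul_zero, Finset.sum_ite_eq', Finset.mem_univ,
        if_true]
      rw [hX.apply_of_notMem hp, hY.apply_of_notMem hp]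

theorem IsAlternating.congruent_of_equivalent (S : Finset (Fin n)) :
    ∀ X Y h k : Matrix (Fin n) (Fin n) F, IsAlternating X → IsAlternating Y →
      (∀ i ∉ S, ∀ q, X i q = 0) → (∀ i ∉ S, ∀ q, Y i q = 0) → InU h → InU k →
      Y = hᵀ * X * k → ∃ g, InU g ∧ Y = gᵀ * X * g := by
  induction S using Finset.strongInduction with
  | H S ih =>
  intro X Y h k hX hY hXS hYS hh hk hYX
  rcases S.eq_empty_or_nonempty with rfl | hne
  · have hX0 : X = 0 := by ext i q; exact hXS i (by simp) q
    have hY0 : Y = 0 := by ext i q; exact hYS i (by simp) q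
    exact ⟨1, InU.one, by simp [hX0, hY0]⟩
  obtain ⟨m, hmS, hmin⟩ : ∃ m ∈ S, ∀ i ∈ S, m ≤ i :=
    ⟨S.min' hne, S.min'_mem hne, fun i hi => S.min'_le i hi⟩
  have hrow : ∀ q, Y m q = ∑ s, X m s * k s q := fun q => by
    rw [hYX]
    exact InU.transpose_mul_mul_row k hh
      (fun i hi => hXS i fun hS => (hmin i hS).not_gt hi) q
  by_cases hz : ∀ q, X m q = 0
  · have hYz : ∀ q, Y m q = 0 := fun q => by simp [hrow, hz]
    refine ih (S.erase m) (Finset.erase_ssubset hmS) X Y h k hX hY ?_ ?_ hh hk hYX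
    · intro i hi q
      rcases eq_or_ne i m with rfl | him
      · exact hz q
      · exact hXS i (by simp_all) q
    · intro i hi q
      rcases eq_or_ne i m with rfl | him
      · exact hYz q
      · exact hYS i (by simp_all) q
  push Not at hz
  obtain ⟨j, hj, hjmin⟩ : ∃ j, X m j ≠ 0 ∧ ∀ i < j, X m i = 0 := by
    obtain ⟨j, hj, hjm⟩ := WellFounded.has_min (wellFounded_lt (α := Fin n)) {q | X m q ≠ 0} hz
    exact ⟨j, hj, fun i hi => by_contra fun h0 => hjm i h0 hi⟩
  have hYj : Y m j = X m j := by
    rw [hrow, Finset.sum_eq_single j]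
    · rw [hk.1, mul_one]
    · intro s _ hs
      rcases lt_or_gt_of_ne hs with hs | hs
      · rw [hjmin s hs, zero_mul]
      · rw [hk.2 s j hs, mul_zero]
    · simp
  have hYjmin : ∀ i < j, Y m i = 0 := fun i hi => by
    rw [hrow]
    refine Finset.sum_eq_zero fun s _ => ?_
    rcases lt_or_ge s j with hs | hs
    · rw [hjmin s hs, zero_mul]
    · rw [hk.2 s i (hi.trans_le hs), mul_zero]
  obtain ⟨u, hu, hXu⟩ := exists_splitsAt hX hXS hmin hj hjmin
  obtain ⟨v, hv, hYv⟩ := exists_splitsAt hY hYS hmin (hYj ▸ hj) hYjmin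
  rw [hYj] at hYv
  obtain ⟨u', hu', huu', hu'u⟩ := hu.exists_inverse
  obtain ⟨v', hv', hvv', hv'v⟩ := hv.exists_inverse
  have hcancel : u'ᵀ * uᵀ = 1 := by rw [← transpose_mul, huu', transpose_one]
  have hcancel_v : v'ᵀ * vᵀ = 1 := by rw [← transpose_mul, hvv', transpose_one]
  have htrans : ∀ A B : Matrix (Fin n) (Fin n) F,
      (u' * A)ᵀ * (uᵀ * X * u) * (u' * B) = Aᵀ * X * B := fun A B => by
    calc _ = Aᵀ * (u'ᵀ * uᵀ) * X * (u * u') * B := by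
          simp only [transpose_mul, Matrix.mul_assoc]
      _ = _ := by rw [hcancel, huu', Matrix.mul_one, Matrix.mul_one]
  have hback : v'ᵀ * (vᵀ * Y * v) * v' = Y := by
    calc _ = (v'ᵀ * vᵀ) * Y * (v * v') := by simp only [Matrix.mul_assoc]
      _ = _ := by rw [hcancel_v, hvv', Matrix.one_mul, Matrix.mul_one]
  have hequiv : vᵀ * Y * v = (u' * (h * v))ᵀ * (uᵀ * X * u) * (u' * (k * v)) := by
    rw [htrans, hYX]
    simp only [transpose_mul, Matrix.mul_assoc]
  have hequiv' : vᵀ * Y * v = (u' * (k * v))ᵀ * (uᵀ * X * u) * (u' * (h * v)) :=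
    hXu.alt.equivalent_swap hYv.alt hequiv
  have hH : InU (u' * (h * v)) := hu'.mul (hh.mul hv)
  have hK : InU (u' * (k * v)) := hu'.mul (hk.mul hv)
  obtain ⟨g, hg, hgeq⟩ := ih ((S.erase m).erase j)
    ((Finset.erase_subset _ _).trans_ssubset (Finset.erase_ssubset hmS))
    _ _ _ _ (hXu.alt.restrictTo _) (hYv.alt.restrictTo _)
    (fun _ hi => restrictTo_of_notMem _ hi)
    (fun _ hi => restrictTo_of_notMem _ hi)
    (hH.cutTo _) (hK.cutTo _)
    (hXu.restrictTo_equivalent (hXu.right_row hYv hj hmin hK hequiv')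
      (hXu.right_row hYv hj hmin hH hequiv) hequiv)
  have hfinal := hXu.congruent_of_restrictTo hYv hgeq
  refine ⟨u * (_root_.cutTo ((S.erase m).erase j) g * v'), hu.mul ((hg.cutTo _).mul hv'), ?_⟩
  rw [← hback, hfinal]
  simp only [transpose_mul, Matrix.mul_assoc]

/-- Two alternating matrices are `U`-congruent iff they are `U`-equivalent. -/
theorem alt_U_congruent_iff_U_equivalent (hn : 2 ≤ n)
    (X Y : Matrix (Fin n) (Fin n) F) (hX : IsAlternating X) (hY : IsAlternating Y) :
    (∃ h : Matrix (Fin n) (Fin n) F, InU h ∧ Y = hᵀ * X * h) ↔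
      (∃ h k : Matrix (Fin n) (Fin n) F, InU h ∧ InU k ∧ Y = hᵀ * X * k) := by
  constructor
  · rintro ⟨h, hh, hYX⟩
    exact ⟨h, h, hh, hh, hYX⟩
  · rintro ⟨h, k, hh, hk, hYX⟩
    exact IsAlternating.congruent_of_equivalent Finset.univ X Y h k hX hY (by simp) (by simp)
      hh hk hYX
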